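/- arXiv:math/9910041 — 3 statements merged into one kernel-verified Lean document; each statement's English description precedes it below -/
import Mathlib

section
/- Let d ≥ 1 and γ > 1. Let (ρ,u) be a global C¹ solution on [0,∞)×ℝ^d of the isentropic Euler system ∂_t ρ + div_x(ρu) = 0, ∂_t u + (u·∇_x)u = −∇_x(ρ^{γ−1}), with ρ(t,·) ≥ 0 compactly supported for each t. Set q = min(2, (γ−1)d) and let R solve R̈ = R^{−(q+1)} with R(0) = R₀ > 0 and Ṙ(0) = 0. Then the function t ↦ R(t)^q ∫_{ℝ^d} ρ(t,x) |u(t,x) − (Ṙ(t)/R(t))x|² dx + R(t)^{−2} ∫_{ℝ^d} ρ(t,x) |x|² dx + (2/γ) R(t)^q ∫_{ℝ^d} ρ(t,x)^γ dx is nonincreasing on [0,∞). -/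
open MeasureTheory Set Real
open scoped ENNReal Topology BigOperators

noncomputable section

section Transport

variable {E : Type*} [NormedAddCommGroup E] [NormedSpace ℝ E]

/-- A `C¹` time-dependent vector field agrees on any bounded region of space-time with a globally
Lipschitz and bounded one. -/
theorem exists_lipschitzWith_bounded_eqOn [FiniteDimensional ℝ E] {w : ℝ × E → E} (hw : ContDiff ℝ 1 w) (N : ℝ) :
    ∃ (v : ℝ × E → E) (L C : NNReal), LipschitzWith L v ∧ (∀ p, ‖v p‖ ≤ C) ∧
      ∀ p, ‖p‖ ≤ N → v p = w p := by
  let χ : ContDiffBump (0 : ℝ × E) := ⟨|N| + 1, |N| + 2, by positivity, by linarith⟩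
  have hv : ContDiff ℝ 1 (fun p => χ p • w p) := χ.contDiff.smul hw
  have hsupp : HasCompactSupport (fun p => χ p • w p) := χ.hasCompactSupport.smul_right
  obtain ⟨L, hL⟩ := hv.lipschitzWith_of_hasCompactSupport hsupp one_ne_zero
  obtain ⟨C, hC⟩ := hv.continuous.bounded_above_of_compact_support hsupp
  refine ⟨_, L, C.toNNReal, hL, fun p => (hC p).trans (le_coe_toNNReal C), fun p hp => ?_⟩
  have : χ p = 1 := χ.one_of_mem_closedBall <| by
    rw [mem_closedBall_zero_iff]
    exact (hp.trans (le_abs_self N)).trans (by simp [χ])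
  simp [this]

/-- Global forward existence for a bounded Lipschitz time-dependent vector field. -/
theorem exists_forall_hasDerivWithinAt_of_lipschitzWith [FiniteDimensional ℝ E] {v : ℝ × E → E} {L C : NNReal}
    (hL : LipschitzWith L v) (hC : ∀ p, ‖v p‖ ≤ C) {T : ℝ} (hT : 0 ≤ T) (x : E) :
    ∃ Y : ℝ → E, Y 0 = x ∧ ∀ s ∈ Icc 0 T, HasDerivWithinAt Y (v (s, Y s)) (Icc 0 T) s := by
  have : CompleteSpace E := FiniteDimensional.complete ℝ E
  have h : IsPicardLindelof (fun s y => v (s, y)) (⟨0, le_refl _, hT⟩ : Icc (0 : ℝ) T) x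
      (C * T.toNNReal) 0 C L := by
    refine ⟨fun t _ => ?_, fun y _ => ?_, fun t _ y _ => hC _, ?_⟩
    · have := hL.comp (LipschitzWith.prodMk_left t (β := E))
      rw [mul_one] at this
      exact this.lipschitzOnWith
    · exact (hL.continuous.comp (by fun_prop)).continuousOn
    · simp [hT]
  exact h.exists_eq_forall_mem_Icc_hasDerivWithinAt₀

theorem HasDerivWithinAt.Ici_of_Icc {F : Type*} [NormedAddCommGroup F] [NormedSpace ℝ F]
    {f : ℝ → F} {f' : F} {a b s : ℝ}
    (h : HasDerivWithinAt f f' (Icc a b) s) (hs : s ∈ Ico a b) :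
    HasDerivWithinAt f f' (Ici s) s :=
  h.mono_of_mem_nhdsWithin (Filter.mem_of_superset (Icc_mem_nhdsGE hs.2)
    (Icc_subset_Icc_left hs.1))

/-- Backward uniqueness from Grönwall's inequality. -/
theorem eq_zero_of_abs_deriv_le_mul_abs_self_of_eq_zero_left {F : Type*} [NormedAddCommGroup F]
    [NormedSpace ℝ F] {f f' : ℝ → F} {K T : ℝ} (hT : 0 ≤ T)
    (hf : ∀ s ∈ Icc 0 T, HasDerivWithinAt f (f' s) (Icc 0 T) s) (h0 : f T = 0)
    (hbound : ∀ s ∈ Icc 0 T, ‖f' s‖ ≤ K * ‖f s‖) : f 0 = 0 := by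
  have hmaps : MapsTo (fun s => T - s) (Icc 0 T) (Icc 0 T) := fun s hs =>
    ⟨sub_nonneg.2 hs.2, sub_le_self _ hs.1⟩
  have hd : ∀ s ∈ Icc 0 T,
      HasDerivWithinAt (fun s => f (T - s)) ((-1 : ℝ) • f' (T - s)) (Icc 0 T) s := fun s hs =>
    (hf _ (hmaps hs)).scomp s ((hasDerivWithinAt_id s _).const_sub T) hmaps
  have := eq_zero_of_abs_deriv_le_mul_abs_self_of_eq_zero_right (K := K)
    (fun s hs => (hd s hs).continuousWithinAt)
    (fun s hs => (hd s (Ico_subset_Icc_self hs)).Ici_of_Icc hs) (by simpa using h0)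
    (fun s hs => by simpa using hbound _ (hmaps (Ico_subset_Icc_self hs))) T ⟨hT, le_rfl⟩
  simpa using this

/-- Chain rule along a time-reversed curve. -/
theorem hasDerivWithinAt_comp_reverse {F : Type*} [NormedAddCommGroup F]
    [NormedSpace ℝ F] {g : ℝ × E → F} (hg : Differentiable ℝ g) {Y : ℝ → E} {y : E} {T s : ℝ}
    {S : Set ℝ} (hY : HasDerivWithinAt Y (-y) S s) :
    HasDerivWithinAt (fun r => g (T - r, Y r)) (-fderiv ℝ g (T - s, Y s) (1, y)) S s := by
  have h1 : HasDerivWithinAt (fun r => (T - r, Y r)) ((-1 : ℝ), -y) S s :=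
    ((hasDerivWithinAt_id s S).const_sub T).prodMk hY
  have := (hg (T - s, Y s)).hasFDerivAt.comp_hasDerivWithinAt s h1
  rwa [show ((-1 : ℝ), -y) = -(1, y) from rfl, map_neg] at this

/-- If density is transported by `u` and particles in vacuum do not accelerate, then the density
propagates from a compact set at finite speed. -/
theorem exists_support_bound [FiniteDimensional ℝ E] {ρ : ℝ × E → ℝ} {u : ℝ × E → E} {k : ℝ × E → ℝ}
    (hρ : ContDiff ℝ 1 ρ) (hu : ContDiff ℝ 1 u) (hk : Continuous k)
    (hsupp : ∀ t, 0 ≤ t → HasCompactSupport (fun x => ρ (t, x)))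
    (hmass : ∀ t, 0 ≤ t → ∀ x, fderiv ℝ ρ (t, x) (1, u (t, x)) = -(k (t, x) * ρ (t, x)))
    (hvac : ∀ t, 0 ≤ t → ∀ x, ρ (t, x) = 0 → fderiv ℝ u (t, x) (1, u (t, x)) = 0) :
    ∃ r V : ℝ, 0 ≤ V ∧ ∀ t, 0 ≤ t → ∀ x, r + t * V < ‖x‖ → ρ (t, x) = 0 := by
  obtain ⟨r, hr⟩ := (hsupp 0 le_rfl).exists_bound_of_continuousOn (f := fun x : E => x)
    continuousOn_id
  obtain ⟨V, hV⟩ := (hsupp 0 le_rfl).exists_bound_of_continuousOn (f := fun x => u (0, x))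
    (by have := hu.continuous; fun_prop)
  refine ⟨max r 0, max V 0, le_max_right _ _, fun T hT x' hx' => ?_⟩
  by_contra hne
  have hcρ := hρ.continuous
  have hcu := hu.continuous
  -- the farthest point of the support at time `T`
  obtain ⟨x, hxs, hxmax⟩ := (hsupp T hT).exists_isMaxOn
    ⟨x', subset_tsupport _ (show ρ (T, x') ≠ 0 from hne)⟩ (f := fun x : E => ‖x‖)
    continuous_norm.continuousOn
  have hx'x : ‖x'‖ ≤ ‖x‖ := hxmax (subset_tsupport _ (show ρ (T, x') ≠ 0 from hne))
  have hTV : 0 ≤ T * max V 0 := mul_nonneg hT (le_max_right _ _)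
  have hx0 : 0 < ‖x‖ := by
    have := le_max_right r 0
    linarith
  have hρx : ρ (T, x) = 0 := by
    by_contra hρx
    have hev : ∀ᶠ c : ℝ in 𝓝[>] 1, ρ (T, c • x) ≠ 0 := by
      have : Filter.Tendsto (fun c : ℝ => ρ (T, c • x)) (𝓝[>] 1) (𝓝 (ρ (T, x))) := by
        have h : Continuous (fun c : ℝ => ρ (T, c • x)) := by fun_prop
        simpa using (h.tendsto 1).mono_left nhdsWithin_le_nhds
      exact this.eventually_ne hρx
    obtain ⟨c, hc, hc1⟩ := (hev.and self_mem_nhdsWithin).exists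
    have hle : ‖c • x‖ ≤ ‖x‖ := hxmax (subset_tsupport _ (show ρ (T, c • x) ≠ 0 from hc))
    rw [norm_smul, Real.norm_eq_abs] at hle
    have hc1 : (1 : ℝ) < c := hc1
    have := le_abs_self c
    nlinarith
  set c := u (T, x) with hc
  set M := ‖x‖ + T * ‖c‖ + 1 with hM
  have hTc : 0 ≤ T * ‖c‖ := by positivity
  obtain ⟨v, L, C, hL, hC, hvw⟩ := exists_lipschitzWith_bounded_eqOn
    (w := fun p => -u (T - p.1, p.2)) (by fun_prop) (max M T)
  have hvw' : ∀ s ∈ Icc 0 T, ∀ y, ‖y‖ ≤ M → v (s, y) = -u (T - s, y) := fun s hs y hy =>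
    hvw (s, y) (by
      rw [Prod.norm_def]
      refine max_le ?_ (hy.trans (le_max_left _ _))
      rw [Real.norm_eq_abs, abs_of_nonneg hs.1]
      exact hs.2.trans (le_max_right _ _))
  have hLs : ∀ s, LipschitzWith L (fun y => v (s, y)) := fun s => by
    have := hL.comp (LipschitzWith.prodMk_left s (β := E))
    rwa [mul_one] at this
  have hcomp : IsCompact (Icc 0 T ×ˢ Metric.closedBall (0 : E) M) :=
    isCompact_Icc.prod (isCompact_closedBall _ _)
  obtain ⟨κ, hκ⟩ := hcomp.exists_bound_of_continuousOn (f := k) hk.continuousOn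
  have hκ' : ∀ s ∈ Icc 0 T, ∀ y, ‖y‖ ≤ M → ‖k (T - s, y)‖ ≤ κ := fun s hs y hy =>
    hκ _ ⟨⟨by simpa using hs.2, by simpa using hs.1⟩, by simpa using hy⟩
  have htransport : ∀ (Y : ℝ → E) (b : ℝ), b ≤ T → ∀ s ∈ Icc 0 b,
      HasDerivWithinAt Y (v (s, Y s)) (Icc 0 b) s → ‖Y s‖ ≤ M →
      HasDerivWithinAt (fun s => ρ (T - s, Y s)) (k (T - s, Y s) * ρ (T - s, Y s)) (Icc 0 b) s ∧
        ‖k (T - s, Y s) * ρ (T - s, Y s)‖ ≤ κ * ‖ρ (T - s, Y s)‖ := by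
    intro Y b hb s hs hY hYM
    have hsT : s ∈ Icc 0 T := ⟨hs.1, hs.2.trans hb⟩
    constructor
    · rw [hvw' s hsT _ hYM] at hY
      have h2 := hasDerivWithinAt_comp_reverse (T := T) (hρ.differentiable one_ne_zero) hY
      rwa [hmass _ (sub_nonneg.2 hsT.2), neg_neg] at h2
    · rw [norm_mul]
      exact mul_le_mul_of_nonneg_right (hκ' s hsT _ hYM) (norm_nonneg _)
  obtain ⟨Y, hY0, hY⟩ := exists_forall_hasDerivWithinAt_of_lipschitzWith hL hC hT x
  have hYc : ContinuousOn Y (Icc 0 T) := fun s hs => (hY s hs).continuousWithinAt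
  -- as long as the trajectory stays in the ball, it is a straight line
  have hline : ∀ b ∈ Icc 0 T, (∀ s ∈ Ico 0 b, ‖Y s‖ ≤ M) →
      (∀ s ∈ Icc 0 b, u (T - s, Y s) = c) ∧ ∀ s ∈ Icc 0 b, Y s = x - s • c := by
    intro b hb hYM
    have hsub : Icc 0 b ⊆ Icc 0 T := Icc_subset_Icc_right hb.2
    have hYb : ∀ s ∈ Icc 0 b, HasDerivWithinAt Y (v (s, Y s)) (Icc 0 b) s :=
      fun s hs => (hY s (hsub hs)).mono hsub
    have hYcb := hYc.mono hsub
    have hz : ∀ s ∈ Icc 0 b, ρ (T - s, Y s) = 0 :=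
      eq_zero_of_abs_deriv_le_mul_abs_self_of_eq_zero_right (K := κ) (by fun_prop)
        (fun s hs => (htransport Y b hb.2 s (Ico_subset_Icc_self hs)
          (hYb s (Ico_subset_Icc_self hs)) (hYM s hs)).1.Ici_of_Icc hs)
        (by simpa [hY0] using hρx)
        (fun s hs => (htransport Y b hb.2 s (Ico_subset_Icc_self hs)
          (hYb s (Ico_subset_Icc_self hs)) (hYM s hs)).2)
    have hYv : ∀ s ∈ Ico 0 b, HasDerivWithinAt Y (-u (T - s, Y s)) (Icc 0 b) s := by
      intro s hs
      have h1 := hYb s (Ico_subset_Icc_self hs)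
      rwa [hvw' s (hsub (Ico_subset_Icc_self hs)) _ (hYM s hs)] at h1
    have hconst : ∀ s ∈ Icc 0 b, u (T - s, Y s) = c := by
      intro s hs
      have := constant_of_has_deriv_right_zero (f := fun s => u (T - s, Y s)) (a := 0) (b := b)
        (by fun_prop) (fun s hs => ?_) s hs
      · simpa [hY0] using this
      · have h2 := hasDerivWithinAt_comp_reverse (T := T)
          (hu.differentiable one_ne_zero) (hYv s hs)
        rw [hvac _ (sub_nonneg.2 (hsub (Ico_subset_Icc_self hs)).2) _
          (hz s (Ico_subset_Icc_self hs)), neg_zero] at h2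
        exact h2.Ici_of_Icc hs
    refine ⟨hconst, fun s hs => ?_⟩
    have := constant_of_has_deriv_right_zero (f := fun s => Y s + s • c) (a := 0) (b := b)
      (by fun_prop) (fun s hs => ?_) s hs
    · simp only [hY0, zero_smul, add_zero] at this
      exact eq_sub_of_add_eq this
    · have h2 := ((hYv s hs).Ici_of_Icc hs).add
        (((hasDerivWithinAt_id s (Ici s)).smul_const c))
      rw [hconst s (Ico_subset_Icc_self hs), one_smul, neg_add_cancel] at h2
      exact h2
  have hlinenorm : ∀ s ∈ Icc 0 T, ‖x - s • c‖ ≤ M - 1 := by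
    intro s hs
    have h1 := norm_sub_le x (s • c)
    rw [norm_smul, Real.norm_eq_abs, abs_of_nonneg hs.1] at h1
    have := mul_le_mul_of_nonneg_right hs.2 (norm_nonneg c)
    linarith
  have hstay : ∀ s ∈ Icc 0 T, ‖Y s‖ < M := by
    by_contra! hcon
    obtain ⟨s₁, hs₁, hs₁M⟩ := hcon
    have hclosed : IsCompact (Icc 0 T ∩ (fun s => ‖Y s‖) ⁻¹' Ici M) :=
      isCompact_Icc.of_isClosed_subset
        (hYc.norm.preimage_isClosed_of_isClosed isClosed_Icc isClosed_Ici) inter_subset_left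
    obtain ⟨τ, ⟨hτ, hτM⟩, hmin⟩ := hclosed.exists_isLeast ⟨s₁, hs₁, hs₁M⟩
    have hbefore : ∀ s ∈ Ico 0 τ, ‖Y s‖ ≤ M := by
      intro s hs
      by_contra! hlt
      exact absurd (hmin ⟨⟨hs.1, hs.2.le.trans hτ.2⟩, hlt.le⟩) (not_le.2 hs.2)
    have hτM : M ≤ ‖Y τ‖ := hτM
    rw [(hline τ hτ hbefore).2 τ ⟨hτ.1, le_rfl⟩] at hτM
    linarith [hlinenorm τ hτ]
  obtain ⟨hconst, hlin⟩ := hline T ⟨hT, le_rfl⟩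
    fun s hs => (hstay s (Ico_subset_Icc_self hs)).le
  have hTT : T ∈ Icc 0 T := ⟨hT, le_rfl⟩
  -- its foot lies in the initial support
  have hfoot : Y T ∈ tsupport (fun y => ρ (0, y)) := by
    refine Metric.mem_closure_iff.2 fun ε hε => ?_
    set δ := min ε 1 / 2 with hδ
    have hδ0 : 0 < δ := by positivity
    obtain ⟨z, hz, hxz⟩ := Metric.mem_closure_iff.1 hxs (δ / Real.exp (L * T)) (by positivity)
    obtain ⟨Z, hZ0, hZ⟩ := exists_forall_hasDerivWithinAt_of_lipschitzWith hL hC hT z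
    have hdist : ∀ s ∈ Icc 0 T, dist (Y s) (Z s) ≤ δ := by
      intro s hs
      have h1 := dist_le_of_trajectories_ODE hLs hYc
        (fun s hs => (hY s (Ico_subset_Icc_self hs)).Ici_of_Icc hs)
        (fun s hs => (hZ s hs).continuousWithinAt)
        (fun s hs => (hZ s (Ico_subset_Icc_self hs)).Ici_of_Icc hs)
        (δ := δ / Real.exp (L * T)) (by rw [hY0, hZ0]; exact hxz.le) s hs
      refine h1.trans ?_
      rw [div_mul_eq_mul_div, div_le_iff₀ (Real.exp_pos _)]
      gcongr
      linarith [hs.2]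
    have hδε : δ < ε := by
      have := min_le_left ε 1
      linarith
    have hδ1 : δ ≤ 1 := by
      have := min_le_right ε 1
      linarith
    refine ⟨Z T, fun h0 => hz ?_, (hdist T hTT).trans_lt hδε⟩
    have hZM : ∀ s ∈ Icc 0 T, ‖Z s‖ ≤ M := by
      intro s hs
      have h1 := hlinenorm s hs
      rw [← hlin s hs] at h1
      have h2 := norm_le_norm_add_norm_sub' (Z s) (Y s)
      rw [← dist_eq_norm, dist_comm] at h2
      linarith [hdist s hs]
    have := eq_zero_of_abs_deriv_le_mul_abs_self_of_eq_zero_left (K := κ) hT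
      (fun s hs => (htransport Z T le_rfl s hs (hZ s hs) (hZM s hs)).1)
      (by simpa using h0)
      (fun s hs => (htransport Z T le_rfl s hs (hZ s hs) (hZM s hs)).2)
    simpa [hZ0] using this
  have h1 : ‖Y T‖ ≤ r := hr _ hfoot
  have h2 : ‖u (0, Y T)‖ ≤ V := hV _ hfoot
  have h3 : u (0, Y T) = c := by simpa using hconst T hTT
  rw [h3] at h2
  have h4 : x = Y T + T • c := by rw [hlin T hTT]; simp
  have h5 : ‖x‖ ≤ r + T * V := by
    rw [h4]
    refine (norm_add_le _ _).trans (add_le_add h1 ?_)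
    rw [norm_smul, Real.norm_eq_abs, abs_of_nonneg hT]
    gcongr
  have := mul_le_mul_of_nonneg_left (le_max_left V 0) hT
  have := le_max_left r 0
  linarith

end Transport

section Divergence

variable {d : ℕ}

/-- The divergence of a vector field on Euclidean space. -/
def euclideanDiv (v : EuclideanSpace ℝ (Fin d) → EuclideanSpace ℝ (Fin d))
    (x : EuclideanSpace ℝ (Fin d)) : ℝ :=
  ∑ i : Fin d, fderiv ℝ v x (EuclideanSpace.single i 1) i

theorem fderiv_euclidean_apply {v : EuclideanSpace ℝ (Fin d) → EuclideanSpace ℝ (Fin d)}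
    {x : EuclideanSpace ℝ (Fin d)} (hv : DifferentiableAt ℝ v x) (i : Fin d)
    (y : EuclideanSpace ℝ (Fin d)) :
    fderiv ℝ (fun z => v z i) x y = fderiv ℝ v x y i := by
  have := ((EuclideanSpace.proj i : EuclideanSpace ℝ (Fin d) →L[ℝ] ℝ).hasFDerivAt.comp x
    hv.hasFDerivAt)
  have h2 : HasFDerivAt (fun z => v z i) _ x := this
  rw [h2.fderiv]
  rfl

theorem euclideanDiv_id (x : EuclideanSpace ℝ (Fin d)) :
    euclideanDiv id x = d := by
  simp [euclideanDiv]

theorem continuous_euclideanDiv {v : EuclideanSpace ℝ (Fin d) → EuclideanSpace ℝ (Fin d)}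
    (hv : ContDiff ℝ 1 v) : Continuous (euclideanDiv v) := by
  have := hv.continuous_fderiv one_ne_zero
  unfold euclideanDiv
  fun_prop

/-- The product rule for the divergence, in coordinates. -/
theorem sum_fderiv_mul_apply {φ : EuclideanSpace ℝ (Fin d) → ℝ}
    {v : EuclideanSpace ℝ (Fin d) → EuclideanSpace ℝ (Fin d)} {x : EuclideanSpace ℝ (Fin d)}
    (hφ : DifferentiableAt ℝ φ x) (hv : DifferentiableAt ℝ v x) :
    ∑ i : Fin d, fderiv ℝ (fun y => φ y * v y i) x (EuclideanSpace.single i 1)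
      = fderiv ℝ φ x (v x) + φ x * euclideanDiv v x := by
  have hi : ∀ i, DifferentiableAt ℝ (fun y => v y i) x := fun i => by fun_prop
  have hsum : v x = ∑ i, v x i • EuclideanSpace.single i (1 : ℝ) := by
    conv_lhs => rw [← (EuclideanSpace.basisFun (Fin d) ℝ).sum_repr (v x)]
    simp
  conv_rhs => rw [hsum, map_sum, euclideanDiv, Finset.mul_sum, ← Finset.sum_add_distrib]
  refine Finset.sum_congr rfl fun i _ => ?_
  rw [fderiv_fun_mul hφ (hi i)]
  simp [fderiv_euclidean_apply hv]
  ring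

/-- The integral of a compactly supported divergence vanishes. -/
theorem integral_fderiv_apply_eq_neg {φ : EuclideanSpace ℝ (Fin d) → ℝ}
    {v : EuclideanSpace ℝ (Fin d) → EuclideanSpace ℝ (Fin d)}
    (hφ : ContDiff ℝ 1 φ) (hφs : HasCompactSupport φ) (hv : ContDiff ℝ 1 v) :
    Integrable (fun x => fderiv ℝ φ x (v x)) ∧ Integrable (fun x => φ x * euclideanDiv v x) ∧
      ∫ x, fderiv ℝ φ x (v x) = -∫ x, φ x * euclideanDiv v x := by
  have hφd := hφ.differentiable one_ne_zero
  have hvd := hv.differentiable one_ne_zero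
  have hcφ := hφ.continuous
  have hcv := hv.continuous
  have hcφ' := hφ.continuous_fderiv one_ne_zero
  have hcv' := hv.continuous_fderiv one_ne_zero
  have hdiv := continuous_euclideanDiv hv
  have hi1 : Integrable (fun x => fderiv ℝ φ x (v x)) := by
    refine Continuous.integrable_of_hasCompactSupport (by fun_prop) ((hφs.fderiv ℝ).mono ?_)
    intro x hx h0
    exact hx (by simp [h0])
  have hi2 : Integrable (fun x => φ x * euclideanDiv v x) :=
    Continuous.integrable_of_hasCompactSupport (by fun_prop) hφs.mul_right
  refine ⟨hi1, hi2, ?_⟩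
  rw [eq_neg_iff_add_eq_zero, ← integral_add hi1 hi2]
  simp_rw [← sum_fderiv_mul_apply (hφd _) (hvd _)]
  have hC : ∀ i, ContDiff ℝ 1 (fun y => φ y * v y i) := fun i => by fun_prop
  have hs : ∀ i, HasCompactSupport (fun y => φ y * v y i) := fun i => hφs.mul_right
  have hint : ∀ i, Integrable (fun x =>
      fderiv ℝ (fun y => φ y * v y i) x (EuclideanSpace.single i 1)) := fun i =>
    (((hC i).continuous_fderiv one_ne_zero).clm_apply
      continuous_const).integrable_of_hasCompactSupport ((hs i).fderiv_apply ℝ _)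
  rw [integral_finsetSum _ fun i _ => hint i]
  refine Finset.sum_eq_zero fun i _ => ?_
  have := integral_mul_fderiv_eq_neg_fderiv_mul_of_integrable (μ := volume)
    (f := fun _ : EuclideanSpace ℝ (Fin d) => (1 : ℝ)) (g := fun y => φ y * v y i)
    (v := EuclideanSpace.single i 1) (by simp) (by simpa using hint i)
    (by simpa using (hC i).continuous.integrable_of_hasCompactSupport (hs i))
    (fun x _ => by fun_prop) (fun x _ => ((hC i).differentiable one_ne_zero) x)
  simpa using this

end Divergence

section Reynolds

/-- Differentiation under the integral sign for locally uniformly compactly supported `C¹`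
integrands. -/
theorem hasDerivAt_integral_of_uniform_support {E : Type*} [NormedAddCommGroup E]
    [NormedSpace ℝ E] [FiniteDimensional ℝ E] [MeasurableSpace E] [BorelSpace E] {μ : Measure E}
    [IsFiniteMeasureOnCompacts μ] {g : ℝ × E → ℝ} (hg : ContDiff ℝ 1 g) {r T t : ℝ}
    (hsupp : ∀ s ∈ Icc 0 T, ∀ x, r < ‖x‖ → g (s, x) = 0) (ht : t ∈ Ioo 0 T) :
    Integrable (fun x => deriv (fun s => g (s, x)) t) μ ∧
      HasDerivAt (fun s => ∫ x, g (s, x) ∂μ) (∫ x, deriv (fun s => g (s, x)) t ∂μ) t := by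
  have hcg := hg.continuous
  have hgd := hg.differentiable one_ne_zero
  have hcg' := hg.continuous_fderiv one_ne_zero
  have hder : ∀ s x, HasDerivAt (fun s => g (s, x)) (fderiv ℝ g (s, x) (1, 0)) s := fun s x =>
    (hgd (s, x)).hasFDerivAt.comp_hasDerivAt s ((hasDerivAt_id s).prodMk (hasDerivAt_const s x))
  have hcs : ∀ s ∈ Icc 0 T, HasCompactSupport fun x => g (s, x) := fun s hs =>
    HasCompactSupport.intro (isCompact_closedBall (0 : E) r) fun x hx =>
      hsupp s hs x (by simpa using hx)
  have hK : IsCompact (Icc 0 T ×ˢ Metric.closedBall (0 : E) r) :=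
    isCompact_Icc.prod (isCompact_closedBall _ _)
  obtain ⟨C, hC⟩ := hK.exists_bound_of_continuousOn (f := fun p => fderiv ℝ g p (1, 0))
    (by fun_prop)
  have hnhds : Ioo 0 T ∈ 𝓝 t := Ioo_mem_nhds ht.1 ht.2
  simp_rw [fun x => (hder t x).deriv]
  refine hasDerivAt_integral_of_dominated_loc_of_deriv_le
    (F' := fun s x => fderiv ℝ g (s, x) (1, 0))
    (bound := (Metric.closedBall (0 : E) r).indicator fun _ => C) hnhds
    (Filter.Eventually.of_forall fun s => ?_) ?_ ?_ (ae_of_all _ fun x s hs => ?_) ?_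
    (ae_of_all _ fun x s _ => hder s x)
  · exact Continuous.aestronglyMeasurable (by fun_prop)
  · exact Continuous.integrable_of_hasCompactSupport (by fun_prop) (hcs t (Ioo_subset_Icc_self ht))
  · exact Continuous.aestronglyMeasurable (by fun_prop)
  · by_cases hx : x ∈ Metric.closedBall (0 : E) r
    · rw [indicator_of_mem hx]
      exact hC (s, x) ⟨Ioo_subset_Icc_self hs, hx⟩
    · rw [indicator_of_notMem hx]
      have h0 : (fun s => g (s, x)) =ᶠ[𝓝 s] fun _ => 0 :=
        Filter.mem_of_superset (Ioo_mem_nhds hs.1 hs.2) fun s' hs' =>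
          hsupp s' (Ioo_subset_Icc_self hs') x (by simpa using hx)
      rw [← (hder s x).deriv, h0.deriv_eq]
      simp
  · exact (integrable_indicator_iff Metric.isClosed_closedBall.measurableSet).2
      (integrableOn_const (isCompact_closedBall _ _).measure_lt_top.ne)

variable {d : ℕ}

/-- Reynolds transport theorem for a density `ρ` carried by `u`, tested against an inner product
of vector fields. -/
theorem hasDerivAt_integral_mul_inner {ρ : ℝ × EuclideanSpace ℝ (Fin d) → ℝ}
    {u a b : ℝ × EuclideanSpace ℝ (Fin d) → EuclideanSpace ℝ (Fin d)}
    (hρ : ContDiff ℝ 1 ρ) (hu : ContDiff ℝ 1 u) (ha : ContDiff ℝ 1 a) (hb : ContDiff ℝ 1 b)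
    {r T t : ℝ} (hsupp : ∀ s ∈ Icc 0 T, ∀ x, r < ‖x‖ → ρ (s, x) = 0) (ht : t ∈ Ioo 0 T)
    (hmass : ∀ x, deriv (fun s => ρ (s, x)) t + (fderiv ℝ (fun y => ρ (t, y)) x (u (t, x))
      + ρ (t, x) * euclideanDiv (fun y => u (t, y)) x) = 0) :
    HasDerivAt (fun s => ∫ x, ρ (s, x) * inner ℝ (a (s, x)) (b (s, x)))
      (∫ x, ρ (t, x) *
        (inner ℝ (a (t, x))
            (deriv (fun s => b (s, x)) t + fderiv ℝ (fun y => b (t, y)) x (u (t, x)))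
          + inner ℝ (deriv (fun s => a (s, x)) t + fderiv ℝ (fun y => a (t, y)) x (u (t, x)))
            (b (t, x)))) t := by
  have hg : ContDiff ℝ 1 (fun p => ρ p * inner ℝ (a p) (b p)) := hρ.mul (ha.inner ℝ hb)
  have hut : ContDiff ℝ 1 (fun y => u (t, y)) := by fun_prop
  have hφ : ContDiff ℝ 1 (fun y => ρ (t, y) * inner ℝ (a (t, y)) (b (t, y))) :=
    hg.comp (contDiff_prodMk_right t)
  have hφs : HasCompactSupport (fun y => ρ (t, y) * inner ℝ (a (t, y)) (b (t, y))) :=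
    HasCompactSupport.intro (isCompact_closedBall (0 : EuclideanSpace ℝ (Fin d)) r) fun x hx => by
      rw [hsupp t (Ioo_subset_Icc_self ht) x (by simpa using hx), zero_mul]
  have hgs : ∀ s ∈ Icc 0 T, ∀ x, r < ‖x‖ → ρ (s, x) * inner ℝ (a (s, x)) (b (s, x)) = 0 :=
    fun s hs x hx => by rw [hsupp s hs x hx, zero_mul]
  obtain ⟨hDi, hD⟩ := hasDerivAt_integral_of_uniform_support (μ := volume) hg hgs ht
  obtain ⟨hi1, hi2, hint⟩ := integral_fderiv_apply_eq_neg hφ hφs hut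
  convert hD using 1
  have hpt : ∀ x, ρ (t, x) *
        (inner ℝ (a (t, x))
            (deriv (fun s => b (s, x)) t + fderiv ℝ (fun y => b (t, y)) x (u (t, x)))
          + inner ℝ (deriv (fun s => a (s, x)) t + fderiv ℝ (fun y => a (t, y)) x (u (t, x)))
            (b (t, x)))
      = deriv (fun s => ρ (s, x) * inner ℝ (a (s, x)) (b (s, x))) t
        + (fderiv ℝ (fun y => ρ (t, y) * inner ℝ (a (t, y)) (b (t, y))) x (u (t, x))
          + ρ (t, x) * inner ℝ (a (t, x)) (b (t, x)) * euclideanDiv (fun y => u (t, y)) x) := by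
    intro x
    have hρd := hρ.differentiable one_ne_zero
    have had := ha.differentiable one_ne_zero
    have hbd := hb.differentiable one_ne_zero
    have e1 : DifferentiableAt ℝ (fun y => ρ (t, y)) x := by fun_prop
    have e2 : DifferentiableAt ℝ (fun y => a (t, y)) x := by fun_prop
    have e3 : DifferentiableAt ℝ (fun y => b (t, y)) x := by fun_prop
    have f1 : DifferentiableAt ℝ (fun s => ρ (s, x)) t := by fun_prop
    have f2 : DifferentiableAt ℝ (fun s => a (s, x)) t := by fun_prop
    have f3 : DifferentiableAt ℝ (fun s => b (s, x)) t := by fun_prop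
    have h1 := hmass x
    rw [fderiv_fun_mul e1 (e2.inner ℝ e3), deriv_fun_mul f1 (f2.inner ℝ f3),
      deriv_inner_apply ℝ f2 f3]
    simp only [add_apply, smul_apply, smul_eq_mul,
      fderiv_inner_apply ℝ e2 e3, inner_add_left, inner_add_right]
    linear_combination (-inner ℝ (a (t, x)) (b (t, x))) * h1
  simp_rw [hpt]
  have hsum := integral_add hi1 hi2
  rw [hint, neg_add_cancel] at hsum
  exact (integral_add hDi (hi1.add hi2)).trans (add_eq_left.2 hsum)

end Reynolds

section Euler

variable {d : ℕ}

/-- The momentum equation weighted by the density, in terms of `ρ ^ γ`. -/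
theorem mul_inner_eq_of_momentum {γ : ℝ} (hγ : 1 < γ) {f : EuclideanSpace ℝ (Fin d) → ℝ}
    (hf : Differentiable ℝ f) {x w : EuclideanSpace ℝ (Fin d)}
    (hw : w + gradient (fun y => f y ^ (γ - 1)) x = 0) (z : EuclideanSpace ℝ (Fin d)) :
    f x * inner ℝ z w = -((γ - 1) / γ * fderiv ℝ (fun y => f y ^ γ) x z) := by
  have hγ0 : γ ≠ 0 := by linarith
  rw [((hf x).hasFDerivAt.rpow_const (Or.inr hγ.le)).fderiv]
  rcases eq_or_ne (f x) 0 with h0 | h0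
  · rw [h0, zero_rpow (by linarith)]
    simp
  · rw [eq_neg_of_add_eq_zero_left hw, inner_neg_right, real_inner_comm, inner_gradient_left,
      ((hf x).hasFDerivAt.rpow_const (Or.inl h0)).fderiv]
    simp only [smul_apply, smul_eq_mul]
    rw [show f x ^ (γ - 1) = f x ^ (γ - 1 - 1) * f x by
      rw [← rpow_add_one h0, sub_add_cancel]]
    field_simp

/-- In vacuum the pressure gradient vanishes. -/
theorem eq_zero_of_momentum_of_eq_zero {γ : ℝ} (hγ : 1 < γ)
    {f : EuclideanSpace ℝ (Fin d) → ℝ} (hf0 : ∀ x, 0 ≤ f x) {x w : EuclideanSpace ℝ (Fin d)}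
    (hw : w + gradient (fun y => f y ^ (γ - 1)) x = 0) (h0 : f x = 0) : w = 0 := by
  have hmin : IsLocalMin (fun y => f y ^ (γ - 1)) x := Filter.Eventually.of_forall fun y => by
    simp only [h0]
    rw [zero_rpow (by linarith)]
    exact rpow_nonneg (hf0 y) _
  rw [gradient, hmin.fderiv_eq_zero, map_zero, add_zero] at hw
  exact hw

/-- Evolution of the energy, of the virial and of the second moment for the isentropic Euler
system. -/
theorem hasDerivAt_euler_moments {γ : ℝ} (hγ : 1 < γ)
    {ρ : ℝ × EuclideanSpace ℝ (Fin d) → ℝ}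
    {u : ℝ × EuclideanSpace ℝ (Fin d) → EuclideanSpace ℝ (Fin d)}
    (hρ : ContDiff ℝ 1 ρ) (hu : ContDiff ℝ 1 u)
    {r T t : ℝ} (hsupp : ∀ s ∈ Icc 0 T, ∀ x, r < ‖x‖ → ρ (s, x) = 0) (ht : t ∈ Ioo 0 T)
    (hmass : ∀ x, deriv (fun s => ρ (s, x)) t + (fderiv ℝ (fun y => ρ (t, y)) x (u (t, x))
      + ρ (t, x) * euclideanDiv (fun y => u (t, y)) x) = 0)
    (hmom : ∀ x, deriv (fun s => u (s, x)) t + fderiv ℝ (fun y => u (t, y)) x (u (t, x))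
        + gradient (fun y => ρ (t, y) ^ (γ - 1)) x = 0) :
    HasDerivAt (fun s => (∫ x, ρ (s, x) * inner ℝ (u (s, x)) (u (s, x)))
        + 2 / γ * ∫ x, ρ (s, x) ^ γ) 0 t ∧
      HasDerivAt (fun s => ∫ x, ρ (s, x) * inner ℝ x (u (s, x)))
        ((∫ x, ρ (t, x) * inner ℝ (u (t, x)) (u (t, x)))
          + (γ - 1) / γ * (d * ∫ x, ρ (t, x) ^ γ)) t ∧
      HasDerivAt (fun s => ∫ x, ρ (s, x) * inner ℝ x x)
        (2 * ∫ x, ρ (t, x) * inner ℝ x (u (t, x))) t := by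
  have hγ0 : γ ≠ 0 := by linarith
  have hσ : ContDiff ℝ 1 (fun p => ρ p ^ γ) :=
    ContDiff.rpow_const_of_le (m := 1) (by exact_mod_cast hρ) (by simpa using hγ.le)
  have hρd := hρ.differentiable one_ne_zero
  have hρt : Differentiable ℝ (fun y => ρ (t, y)) := by fun_prop
  have hut : ContDiff ℝ 1 (fun y => u (t, y)) := by fun_prop
  have hσt : ContDiff ℝ 1 (fun y => ρ (t, y) ^ γ) := hσ.comp (contDiff_prodMk_right t)
  have hσ0 : ∀ s ∈ Icc 0 T, ∀ x, r < ‖x‖ → ρ (s, x) ^ γ = 0 := fun s hs x hx => by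
    rw [hsupp s hs x hx, zero_rpow hγ0]
  have hσs : HasCompactSupport (fun y => ρ (t, y) ^ γ) :=
    HasCompactSupport.intro (isCompact_closedBall (0 : EuclideanSpace ℝ (Fin d)) r) fun x hx =>
      hσ0 t (Ioo_subset_Icc_self ht) x (by simpa using hx)
  have hw := fun x => mul_inner_eq_of_momentum hγ hρt (hmom x)
  obtain ⟨hu1, hu2, hu3⟩ := integral_fderiv_apply_eq_neg hσt hσs hut
  obtain ⟨hx1, hx2, hx3⟩ := integral_fderiv_apply_eq_neg hσt hσs contDiff_id
  simp only [id_def, euclideanDiv_id] at hx1 hx2 hx3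
  have hD := fun {a b} (ha : ContDiff ℝ 1 a) (hb : ContDiff ℝ 1 b) =>
    hasDerivAt_integral_mul_inner (a := a) (b := b) hρ hu ha hb hsupp ht hmass
  have hσder : ∀ x, deriv (fun s => ρ (s, x) ^ γ) t
      = -fderiv ℝ (fun y => ρ (t, y) ^ γ) x (u (t, x))
        - γ * (ρ (t, x) ^ γ * euclideanDiv (fun y => u (t, y)) x) := by
    intro x
    have f1 : DifferentiableAt ℝ (fun s => ρ (s, x)) t := by fun_prop
    rw [(f1.hasDerivAt.rpow_const (Or.inr hγ.le)).deriv,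
      ((hρt x).hasFDerivAt.rpow_const (Or.inr hγ.le)).fderiv,
      eq_neg_of_add_eq_zero_left (hmass x)]
    have hpow : ρ (t, x) ^ γ = ρ (t, x) ^ (γ - 1) * ρ (t, x) := by
      rcases eq_or_ne (ρ (t, x)) 0 with h0 | h0
      · rw [h0, zero_rpow hγ0, mul_zero]
      · rw [← rpow_add_one h0, sub_add_cancel]
    rw [hpow]
    simp only [smul_apply, smul_eq_mul]
    ring
  refine ⟨?_, ?_, ?_⟩
  · have h1 := hD hu hu
    have h2 := (hasDerivAt_integral_of_uniform_support (μ := volume) hσ hσ0 ht).2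
    simp_rw [hσder] at h2
    have hneg : Integrable (fun x => -fderiv ℝ (fun y => ρ (t, y) ^ γ) x (u (t, x))) := hu1.neg
    rw [integral_sub hneg (hu2.const_mul γ), integral_neg, integral_const_mul] at h2
    have e1 : ∀ x, ρ (t, x) * (inner ℝ (u (t, x))
          (deriv (fun s => u (s, x)) t + fderiv ℝ (fun y => u (t, y)) x (u (t, x)))
        + inner ℝ (deriv (fun s => u (s, x)) t + fderiv ℝ (fun y => u (t, y)) x (u (t, x)))
          (u (t, x)))
        = -(2 * (γ - 1) / γ) * fderiv ℝ (fun y => ρ (t, y) ^ γ) x (u (t, x)) := by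
      intro x
      rw [real_inner_comm (u (t, x)), mul_add, hw]
      ring
    simp_rw [e1] at h1
    rw [integral_const_mul] at h1
    refine (h1.add (h2.const_mul (2 / γ))).congr_deriv ?_
    rw [hu3]
    field_simp
    ring
  · have h1 := hD contDiff_snd hu
    refine h1.congr_deriv ?_
    have e1 : ∀ x, ρ (t, x) * (inner ℝ x
          (deriv (fun s => u (s, x)) t + fderiv ℝ (fun y => u (t, y)) x (u (t, x)))
        + inner ℝ (deriv (fun _ : ℝ => x) t
            + fderiv ℝ (fun y : EuclideanSpace ℝ (Fin d) => y) x (u (t, x))) (u (t, x)))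
        = ρ (t, x) * inner ℝ (u (t, x)) (u (t, x))
          + (-((γ - 1) / γ)) * fderiv ℝ (fun y => ρ (t, y) ^ γ) x x := by
      intro x
      rw [mul_add, hw]
      simp
      ring
    simp_rw [e1]
    have hi : Integrable (fun x => ρ (t, x) * inner ℝ (u (t, x)) (u (t, x))) := by
      refine Continuous.integrable_of_hasCompactSupport ?_
        (HasCompactSupport.intro (isCompact_closedBall (0 : EuclideanSpace ℝ (Fin d)) r)
          fun x hx => ?_)
      · have := hu.continuous
        have := hρ.continuous
        fun_prop
      · rw [hsupp t (Ioo_subset_Icc_self ht) x (by simpa using hx), zero_mul]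
    rw [integral_add hi (hx1.const_mul _), integral_const_mul, hx3, integral_mul_const]
    ring
  · have h1 := hD contDiff_snd contDiff_snd
    refine h1.congr_deriv ?_
    rw [← integral_const_mul]
    congr 1
    ext x
    simp [real_inner_comm x]
    ring

end Euler

theorem fderiv_apply_one_prodMk {E F : Type*} [NormedAddCommGroup E] [NormedSpace ℝ E]
    [NormedAddCommGroup F] [NormedSpace ℝ F] {g : ℝ × E → F} {t : ℝ} {x : E}
    (hg : DifferentiableAt ℝ g (t, x)) (v : E) :
    fderiv ℝ g (t, x) (1, v)
      = deriv (fun s => g (s, x)) t + fderiv ℝ (fun y => g (t, y)) x v := by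
  have h1 : HasDerivAt (fun s => g (s, x)) (fderiv ℝ g (t, x) (1, 0)) t :=
    hg.hasFDerivAt.comp_hasDerivAt t ((hasDerivAt_id t).prodMk (hasDerivAt_const t x))
  have h2 : HasFDerivAt (fun y => g (t, y))
      ((fderiv ℝ g (t, x)).comp (ContinuousLinearMap.inr ℝ ℝ E)) x :=
    hg.hasFDerivAt.comp x (hasFDerivAt_prodMk_right t x)
  rw [h1.deriv, h2.fderiv]
  simp [← map_add]

theorem continuous_uncurry_euclideanDiv {d : ℕ}
    {u : ℝ × EuclideanSpace ℝ (Fin d) → EuclideanSpace ℝ (Fin d)} (hu : ContDiff ℝ 1 u) :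
    Continuous fun p : ℝ × EuclideanSpace ℝ (Fin d) =>
      euclideanDiv (fun y => u (p.1, y)) p.2 := by
  have h : ∀ p : ℝ × EuclideanSpace ℝ (Fin d), fderiv ℝ (fun y => u (p.1, y)) p.2
      = (fderiv ℝ u p).comp (ContinuousLinearMap.inr ℝ ℝ (EuclideanSpace ℝ (Fin d))) := fun p =>
    ((hu.differentiable one_ne_zero p).hasFDerivAt.comp p.2
      (hasFDerivAt_prodMk_right p.1 p.2)).fderiv
  have := hu.continuous_fderiv one_ne_zero
  simp only [euclideanDiv, h]
  fun_prop

/-- Derivative of the rescaled energy, when the total energy `A` is conserved and the virial `B`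
and the second moment `C` evolve according to the system. -/
theorem hasDerivAt_rescaled_energy {R A B C : ℝ → ℝ} {q t B' : ℝ} (hRt : 0 < R t)
    (hR : DifferentiableAt ℝ R t) (hR' : HasDerivAt (deriv R) (R t ^ (-(q + 1))) t)
    (hA : HasDerivAt A 0 t) (hB : HasDerivAt B B' t) (hC : HasDerivAt C (2 * B t) t) :
    HasDerivAt (fun s => R s ^ q * (A s - 2 * (deriv R s / R s) * B s + (deriv R s / R s) ^ 2 * C s)
        + R s ^ (-2 : ℝ) * C s)
      (R t ^ q * (deriv R t / R t) * (q * (A t - 2 * (deriv R t / R t) * B t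
          + (deriv R t / R t) ^ 2 * C t) + 4 * (deriv R t / R t) * B t
          - 2 * (deriv R t / R t) ^ 2 * C t - 2 * B')) t := by
  have hq := hR.hasDerivAt.rpow_const (p := q) (Or.inl hRt.ne')
  have h2 := hR.hasDerivAt.rpow_const (p := -2) (Or.inl hRt.ne')
  have ha := hR'.div hR.hasDerivAt hRt.ne'
  have := (hq.mul ((hA.sub ((ha.const_mul 2).mul hB)).add ((ha.pow 2).mul hC))).add (h2.mul hC)
  refine this.congr_deriv ?_
  have e1 : R t ^ (q - 1) = R t ^ q / R t := rpow_sub_one hRt.ne' q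
  have e2 : R t ^ (-(q + 1)) = 1 / (R t ^ q * R t) := by
    rw [rpow_neg hRt.le, rpow_add_one hRt.ne', one_div]
  have e3 : R t ^ (-2 : ℝ) = 1 / R t ^ 2 := by
    rw [rpow_neg hRt.le, one_div]
    norm_cast
  have e4 : R t ^ (-2 - 1 : ℝ) = 1 / R t ^ 3 := by
    rw [rpow_sub_one hRt.ne', e3]
    field_simp
  have hQ : R t ^ q ≠ 0 := (rpow_pos_of_pos hRt q).ne'
  simp only [e1, e2, e3, e4, Pi.sub_apply, Pi.add_apply, Pi.mul_apply, Pi.div_apply, Pi.pow_apply,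
    Nat.add_one_sub_one, pow_one]
  field_simp
  ring

/-- dispersion for the isentropic Euler system for perfect gases
(`γ > 1`): with `q = min(2,(γ-1)d)` and `R̈ = R^{-(q+1)}`, `R(0)=R₀>0`, `Ṙ(0)=0`,
the functional `R^q ∫ ρ|u-(Ṙ/R)x|² + R^{-2} ∫ ρ|x|² + (2/γ)R^q ∫ ρ^γ` is
nonincreasing on `[0,∞)`. -/
theorem stmt9 (d : ℕ) (hd : 1 ≤ d) (γ : ℝ) (hγ : 1 < γ) (q R₀ : ℝ)
    (hq : q = min 2 ((γ - 1) * d)) (hR₀ : 0 < R₀)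
    (ρ : ℝ → EuclideanSpace ℝ (Fin d) → ℝ)
    (u : ℝ → EuclideanSpace ℝ (Fin d) → EuclideanSpace ℝ (Fin d))
    (R : ℝ → ℝ)
    -- the rescaling function: `R̈ = R^{-(q+1)}`, `R(0)=R₀`, `Ṙ(0)=0`
    (hR : ContDiff ℝ 2 R) (hR0 : R 0 = R₀) (hR'0 : deriv R 0 = 0)
    (hRpos : ∀ t : ℝ, 0 ≤ t → 0 < R t)
    (hRode : ∀ t : ℝ, 0 ≤ t → deriv (deriv R) t = R t ^ (-(q + 1)))
    -- `(ρ,u)` is a global C¹ solution, `ρ ≥ 0` compactly supported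
    (hρ_C1 : ContDiff ℝ 1 (fun p : ℝ × EuclideanSpace ℝ (Fin d) => ρ p.1 p.2))
    (hu_C1 : ContDiff ℝ 1 (fun p : ℝ × EuclideanSpace ℝ (Fin d) => u p.1 p.2))
    (hρ_nonneg : ∀ t x, 0 ≤ ρ t x)
    (hρ_supp : ∀ t : ℝ, HasCompactSupport (fun x => ρ t x))
    -- continuity equation `∂_t ρ + div(ρu) = 0`
    (hcontinuity : ∀ t : ℝ, 0 ≤ t → ∀ x,
      deriv (fun s => ρ s x) t
        + ∑ i : Fin d, fderiv ℝ (fun y => ρ t y * u t y i) x (EuclideanSpace.single i 1) = 0)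
    -- momentum equation `∂_t u + (u·∇)u = −∇(ρ^{γ-1})`
    (hmomentum : ∀ t : ℝ, 0 ≤ t → ∀ x,
      deriv (fun s => u s x) t + fderiv ℝ (fun y => u t y) x (u t x)
        + gradient (fun y => ρ t y ^ (γ - 1)) x = 0) :
    AntitoneOn (fun t =>
      R t ^ q * (∫ x, ρ t x * ‖u t x - (deriv R t / R t) • x‖ ^ 2)
        + R t ^ (-2 : ℝ) * (∫ x, ρ t x * ‖x‖ ^ 2)
        + (2 / γ) * R t ^ q * ∫ x, ρ t x ^ γ) (Ici 0) := by
  intro t₀ ht₀ T hT ht₀T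
  have hT0 : (0 : ℝ) ≤ T := hT
  have hcρ := hρ_C1.continuous
  have hcu := hu_C1.continuous
  have hγ0 : γ ≠ 0 := by linarith
  have hρd := hρ_C1.differentiable one_ne_zero
  have hud := hu_C1.differentiable one_ne_zero
  have hmass : ∀ t : ℝ, 0 ≤ t → ∀ x, deriv (fun s => ρ s x) t
      + (fderiv ℝ (fun y => ρ t y) x (u t x) + ρ t x * euclideanDiv (fun y => u t y) x) = 0 := by
    intro t ht x
    have e1 : DifferentiableAt ℝ (fun y => ρ t y) x :=
      (hρd.comp (differentiable_const t |>.prodMk differentiable_id)) x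
    have e2 : DifferentiableAt ℝ (fun y => u t y) x :=
      (hud.comp (differentiable_const t |>.prodMk differentiable_id)) x
    rw [← sum_fderiv_mul_apply e1 e2]
    exact hcontinuity t ht x
  obtain ⟨r₀, V, hV, hsupp₀⟩ := exists_support_bound hρ_C1 hu_C1
    (continuous_uncurry_euclideanDiv hu_C1) (fun t _ => hρ_supp t)
    (fun t ht x => by
      rw [fderiv_apply_one_prodMk (hρd _)]
      linear_combination hmass t ht x)
    (fun t ht x h0 => by
      rw [fderiv_apply_one_prodMk (hud _)]
      exact eq_zero_of_momentum_of_eq_zero hγ (hρ_nonneg t) (hmomentum t ht x) h0)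
  set r := r₀ + T * V
  have hsupp : ∀ s ∈ Icc 0 T, ∀ x, r < ‖x‖ → ρ s x = 0 := fun s hs x hx =>
    hsupp₀ s hs.1 x (lt_of_le_of_lt (by simp only [r]; gcongr; exact hs.2) hx)
  have hmoments := fun t (ht : t ∈ Ioo 0 T) =>
    hasDerivAt_euler_moments hγ hρ_C1 hu_C1 hsupp ht (hmass t ht.1.le) (hmomentum t ht.1.le)
  set A : ℝ → ℝ := fun s => (∫ x, ρ s x * inner ℝ (u s x) (u s x)) + 2 / γ * ∫ x, ρ s x ^ γ
  set B : ℝ → ℝ := fun s => ∫ x, ρ s x * inner ℝ x (u s x)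
  set C : ℝ → ℝ := fun s => ∫ x, ρ s x * inner ℝ x x
  have hball := isCompact_closedBall (0 : EuclideanSpace ℝ (Fin d)) r
  have hout : ∀ s ∈ Icc 0 T, ∀ x ∉ Metric.closedBall (0 : EuclideanSpace ℝ (Fin d)) r,
      ρ s x = 0 := fun s hs x hx => hsupp s hs x (by simpa using hx)
  have hAc : ContinuousOn A (Icc 0 T) := by
    refine (continuousOn_integral_of_compact_support hball (Continuous.continuousOn ?_)
      fun s x hs hx => ?_).add ((continuousOn_integral_of_compact_support hball
        (Continuous.continuousOn ?_) fun s x hs hx => ?_).const_mul _)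
    · exact hcρ.mul (hcu.inner hcu)
    · rw [hout s hs x hx, zero_mul]
    · exact hcρ.rpow_const fun _ => Or.inr (by linarith)
    · rw [hout s hs x hx, zero_rpow hγ0]
  have hBc : ContinuousOn B (Icc 0 T) := by
    refine continuousOn_integral_of_compact_support hball (Continuous.continuousOn ?_)
      fun s x hs hx => ?_
    · exact hcρ.mul (continuous_snd.inner hcu)
    · rw [hout s hs x hx, zero_mul]
  have hCc : ContinuousOn C (Icc 0 T) := by
    refine continuousOn_integral_of_compact_support hball (Continuous.continuousOn ?_)
      fun s x hs hx => ?_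
    · exact hcρ.mul (continuous_snd.inner continuous_snd)
    · rw [hout s hs x hx, zero_mul]
  have hR' : ContDiff ℝ 1 (deriv R) := (contDiff_succ_iff_deriv (n := 1).1 hR).2.2
  have hRd : Differentiable ℝ R := hR.differentiable two_ne_zero
  have hR'd := hR'.differentiable one_ne_zero
  have hRc := hR.continuous
  have hR'c := hR'.continuous
  have hR'nonneg : ∀ t, 0 ≤ t → 0 ≤ deriv R t := by
    intro t ht
    have := monotoneOn_of_deriv_nonneg (convex_Ici 0) hR'c.continuousOn hR'd.differentiableOn
      (fun s hs => ?_) (self_mem_Ici : (0 : ℝ) ∈ Ici 0) ht ht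
    · rwa [hR'0] at this
    · rw [interior_Ici] at hs
      rw [hRode s (le_of_lt hs)]
      exact rpow_nonneg (hRpos s (le_of_lt hs)).le _
  have hW : ∀ s, ∫ x, ρ s x * ‖u s x - (deriv R s / R s) • x‖ ^ 2
      = A s - 2 / γ * (∫ x, ρ s x ^ γ) - 2 * (deriv R s / R s) * B s
        + (deriv R s / R s) ^ 2 * C s := by
    intro s
    have hρs : Continuous (fun x => ρ s x) := hcρ.comp (by fun_prop : Continuous fun x => (s, x))
    have hus : Continuous (fun x => u s x) := hcu.comp (by fun_prop : Continuous fun x => (s, x))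
    have hint : ∀ a b : EuclideanSpace ℝ (Fin d) → EuclideanSpace ℝ (Fin d), Continuous a →
        Continuous b → Integrable fun x => ρ s x * inner ℝ (a x) (b x) := fun a b ha hb =>
      (hρs.mul (ha.inner hb)).integrable_of_hasCompactSupport (hρ_supp s).mul_right
    have e : ∀ x, ρ s x * ‖u s x - (deriv R s / R s) • x‖ ^ 2
        = ρ s x * inner ℝ (u s x) (u s x) - 2 * (deriv R s / R s) * (ρ s x * inner ℝ x (u s x))
          + (deriv R s / R s) ^ 2 * (ρ s x * inner ℝ x x) := by
      intro x
      rw [← real_inner_self_eq_norm_sq]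
      simp only [inner_sub_left, inner_sub_right, inner_smul_left, inner_smul_right,
        real_inner_comm x (u s x)]
      simp
      ring
    simp_rw [e]
    have i1 := hint _ _ hus hus
    have i2 := (hint _ _ continuous_id hus).const_mul (2 * (deriv R s / R s))
    have i3 := (hint _ _ continuous_id continuous_id).const_mul ((deriv R s / R s) ^ 2)
    have h1 := integral_add (i1.sub i2) i3
    have h2 := integral_sub i1 i2
    simp only [Pi.sub_apply, id_def, integral_const_mul] at h1 h2
    rw [h1, h2]
    simp only [A, B, C]
    ring
  have hEq : ∀ s, 0 ≤ s → R s ^ q * (∫ x, ρ s x * ‖u s x - (deriv R s / R s) • x‖ ^ 2)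
        + R s ^ (-2 : ℝ) * (∫ x, ρ s x * ‖x‖ ^ 2) + (2 / γ) * R s ^ q * ∫ x, ρ s x ^ γ
      = R s ^ q * (A s - 2 * (deriv R s / R s) * B s + (deriv R s / R s) ^ 2 * C s)
        + R s ^ (-2 : ℝ) * C s := by
    intro s hs
    rw [hW s]
    simp_rw [← real_inner_self_eq_norm_sq]
    ring
  simp only [hEq t₀ ht₀, hEq T hT]
  have hF := fun t (ht : t ∈ Ioo 0 T) => hasDerivAt_rescaled_energy (hRpos t ht.1.le) (hRd t)
    (by rw [← hRode t ht.1.le]; exact (hR'd t).hasDerivAt)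
    (hmoments t ht).1 (hmoments t ht).2.1 (hmoments t ht).2.2
  suffices hanti : AntitoneOn (fun s => R s ^ q * (A s - 2 * (deriv R s / R s) * B s
      + (deriv R s / R s) ^ 2 * C s) + R s ^ (-2 : ℝ) * C s) (Icc 0 T) from
    hanti ⟨ht₀, ht₀T⟩ (right_mem_Icc.2 hT0) ht₀T
  refine antitoneOn_of_deriv_nonpos (convex_Icc 0 T) ?_ ?_ ?_
  · have hne : ∀ s ∈ Icc 0 T, R s ≠ 0 := fun s hs => (hRpos s hs.1).ne'
    have ha : ContinuousOn (fun s => deriv R s / R s) (Icc 0 T) :=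
      hR'c.continuousOn.div hRc.continuousOn hne
    have hRq : ∀ p : ℝ, ContinuousOn (fun s => R s ^ p) (Icc 0 T) := fun p =>
      hRc.continuousOn.rpow_const fun s hs => Or.inl (hne s hs)
    exact ((hRq q).mul ((hAc.sub ((ha.const_mul 2).mul hBc)).add ((ha.pow 2).mul hCc))).add
      ((hRq _).mul hCc)
  · rw [interior_Icc]
    exact fun t ht => (hF t ht).differentiableAt.differentiableWithinAt
  · rw [interior_Icc]
    intro t ht
    have ht0 := ht.1.le
    rw [(hF t ht).deriv]
    have hWnonneg : 0 ≤ ∫ x, ρ t x * ‖u t x - (deriv R t / R t) • x‖ ^ 2 :=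
      integral_nonneg fun x => mul_nonneg (hρ_nonneg t x) (sq_nonneg _)
    have hPnonneg : 0 ≤ 2 / γ * ∫ x, ρ t x ^ γ :=
      mul_nonneg (by positivity) (integral_nonneg fun x => rpow_nonneg (hρ_nonneg t x) γ)
    have hWt := hW t
    have hK : ∫ x, ρ t x * inner ℝ (u t x) (u t x) = A t - 2 / γ * ∫ x, ρ t x ^ γ := by
      simp only [A]
      ring
    refine mul_nonpos_of_nonneg_of_nonpos (mul_nonneg (rpow_nonneg (hRpos t ht0).le q)
      (div_nonneg (hR'nonneg t ht0) (hRpos t ht0).le)) ?_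
    have hq2 : q ≤ 2 := hq ▸ min_le_left _ _
    have hqd : q ≤ (γ - 1) * d := hq ▸ min_le_right _ _
    have h1 := mul_nonneg (sub_nonneg.2 hq2) hWnonneg
    have h2 := mul_nonneg (sub_nonneg.2 hqd) hPnonneg
    rw [hWt] at h1
    rw [hK]
    have e : (γ - 1) / γ * (d * ∫ x, ρ t x ^ γ)
        = (γ - 1) * d * (2 / γ * ∫ x, ρ t x ^ γ) / 2 := by ring
    rw [e]
    linear_combination h1 + h2
end
end

section
/- Let ρ : ℝ² → [0,∞) be measurable with M = ∫_{ℝ²} ρ(x) dx ∈ (0,∞) and I = ∫_{ℝ²} |x|² ρ(x) dx ∈ (0,∞), and assume that (x,y) ↦ log|x−y| ρ(x)ρ(y) is integrable on ℝ²×ℝ². Then −(1/2π) ∬_{ℝ²×ℝ²} log|x−y| ρ(x) ρ(y) dx dy ≥ −(M²/4π) log( 2I/M ). -/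
open MeasureTheory Set Real
open scoped Topology

noncomputable section

/-- The tangent line bound for `log` at `a`, applied to `t ^ 2`. -/
lemma two_mul_log_le_of_pos {a t : ℝ} (ha : 0 < a) (ht : 0 < t) :
    2 * Real.log t ≤ Real.log a - 1 + a⁻¹ * t ^ 2 := by
  have h := Real.log_le_sub_one_of_pos (show 0 < a⁻¹ * t ^ 2 by positivity)
  rw [Real.log_mul (by positivity) (by positivity), Real.log_inv, Real.log_pow] at h
  push_cast at h
  linarith

lemma ae_prod_fst_ne_snd {α : Type*} [MeasurableSpace α] [MeasurableEq α] {μ : Measure α}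
    [SFinite μ] [NullSingletonClass μ] : ∀ᵐ p : α × α ∂(μ.prod μ), p.1 ≠ p.2 := by
  have hmeas : MeasurableSet {p : α × α | p.1 ≠ p.2} :=
    measurableSet_diagonal.compl
  rw [Measure.ae_prod_iff_ae_ae hmeas]
  filter_upwards with x
  filter_upwards [Measure.ae_ne μ x] with y hy
  exact hy.symm

section InnerProductSpace

variable {E : Type*} [NormedAddCommGroup E] [InnerProductSpace ℝ E]

lemma sq_norm_sub_mul_mul_eq (x y : E) (r s : ℝ) :
    ‖x - y‖ ^ 2 * (r * s) =
      (‖x‖ ^ 2 * r) * s + r * (‖y‖ ^ 2 * s) - 2 * inner ℝ (r • x) (s • y) := by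
  rw [norm_sub_sq_real, real_inner_smul_left, real_inner_smul_right]
  ring

variable [MeasurableSpace E] {μ : Measure E}

lemma integrable_inner_prod {f : E → E} (hf : Integrable f μ) :
    Integrable (fun p : E × E => inner ℝ (f p.1) (f p.2)) (μ.prod μ) := by
  refine (hf.norm.mul_prod hf.norm).mono'
    (hf.aestronglyMeasurable.comp_fst.inner hf.aestronglyMeasurable.comp_snd) ?_
  filter_upwards with p
  exact norm_inner_le_norm _ _

lemma integral_inner_prod_nonneg [CompleteSpace E] [SFinite μ] {f : E → E} (hf : Integrable f μ) :
    0 ≤ ∫ p : E × E, inner ℝ (f p.1) (f p.2) ∂(μ.prod μ) := by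
  rw [integral_prod _ (integrable_inner_prod hf)]
  have h (x : E) : ∫ y, inner ℝ (f x) (f y) ∂μ = inner ℝ (∫ y, f y ∂μ) (f x) := by
    rw [integral_inner hf, real_inner_comm]
  simp_rw [h]
  rw [integral_inner hf]
  exact real_inner_self_nonneg

variable [BorelSpace E] [SecondCountableTopology E] {ρ : E → ℝ}

lemma integrable_smul_id_of_sq_moment (hρ : ∀ x, 0 ≤ ρ x) (hint : Integrable ρ μ)
    (hmom : Integrable (fun x => ‖x‖ ^ 2 * ρ x) μ) : Integrable (fun x => ρ x • x) μ := by
  refine (hint.add hmom).mono' (hint.aestronglyMeasurable.smul aestronglyMeasurable_id) ?_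
  filter_upwards with x
  rw [norm_smul, Real.norm_of_nonneg (hρ x), Pi.add_apply]
  nlinarith [mul_nonneg (hρ x) (sq_nonneg (‖x‖ - 1)), mul_nonneg (hρ x) (norm_nonneg x),
    mul_nonneg (hρ x) (sq_nonneg ‖x‖)]

lemma integrable_sq_norm_sub_mul (hρ : ∀ x, 0 ≤ ρ x) (hint : Integrable ρ μ)
    (hmom : Integrable (fun x => ‖x‖ ^ 2 * ρ x) μ) :
    Integrable (fun p : E × E => ‖p.1 - p.2‖ ^ 2 * (ρ p.1 * ρ p.2)) (μ.prod μ) := by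
  simp_rw [sq_norm_sub_mul_mul_eq]
  exact ((hmom.mul_prod hint).add (hint.mul_prod hmom)).sub
    ((integrable_inner_prod (integrable_smul_id_of_sq_moment hρ hint hmom)).const_mul 2)

lemma integral_sq_norm_sub_mul_le [CompleteSpace E] [SFinite μ] (hρ : ∀ x, 0 ≤ ρ x)
    (hint : Integrable ρ μ) (hmom : Integrable (fun x => ‖x‖ ^ 2 * ρ x) μ) :
    ∫ p : E × E, ‖p.1 - p.2‖ ^ 2 * (ρ p.1 * ρ p.2) ∂(μ.prod μ) ≤
      2 * (∫ x, ρ x ∂μ) * ∫ x, ‖x‖ ^ 2 * ρ x ∂μ := by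
  have hf := integrable_smul_id_of_sq_moment hρ hint hmom
  have h₁ := hmom.mul_prod hint
  have h₂ := hint.mul_prod hmom
  have h₁₂ : Integrable
      (fun p : E × E => ‖p.1‖ ^ 2 * ρ p.1 * ρ p.2 + ρ p.1 * (‖p.2‖ ^ 2 * ρ p.2)) (μ.prod μ) :=
    h₁.add h₂
  simp_rw [sq_norm_sub_mul_mul_eq]
  rw [integral_sub h₁₂ ((integrable_inner_prod hf).const_mul 2), integral_add h₁ h₂,
    integral_const_mul, integral_prod_mul (fun x => ‖x‖ ^ 2 * ρ x) ρ,
    integral_prod_mul ρ (fun x => ‖x‖ ^ 2 * ρ x)]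
  linarith [integral_inner_prod_nonneg hf]

end InnerProductSpace

/-- Jensen lower bound for the 2-d logarithmic interaction energy:
`-(1/2π) ∬ log|x-y| ρ(x)ρ(y) dx dy ≥ -(M²/4π) log(2I/M)` where `M` is the mass and
`I` the second moment of `ρ`. -/
theorem stmt15 (ρ : EuclideanSpace ℝ (Fin 2) → ℝ) (M I : ℝ)
    (hρ_meas : Measurable ρ) (hρ_nonneg : ∀ x, 0 ≤ ρ x)
    (hρ_int : Integrable ρ)
    (hmom_int : Integrable (fun x => ‖x‖ ^ 2 * ρ x))
    (hM : (∫ x, ρ x) = M) (hMpos : 0 < M)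
    (hI : (∫ x, ‖x‖ ^ 2 * ρ x) = I) (hIpos : 0 < I)
    (hker_int : Integrable
      (fun p : EuclideanSpace ℝ (Fin 2) × EuclideanSpace ℝ (Fin 2) =>
        Real.log ‖p.1 - p.2‖ * (ρ p.1 * ρ p.2))) :
    -(M ^ 2 / (4 * π)) * Real.log (2 * I / M) ≤
      -(1 / (2 * π)) *
        ∫ p : EuclideanSpace ℝ (Fin 2) × EuclideanSpace ℝ (Fin 2),
          Real.log ‖p.1 - p.2‖ * (ρ p.1 * ρ p.2) := by
  have ha : 0 < 2 * I / M := by positivity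
  set a := 2 * I / M with ha_def
  have hρρ := hρ_int.mul_prod hρ_int
  have hsq := integrable_sq_norm_sub_mul hρ_nonneg hρ_int hmom_int
  have hle := integral_sq_norm_sub_mul_le hρ_nonneg hρ_int hmom_int
  rw [hM, hI] at hle
  rw [Measure.volume_eq_prod] at hker_int ⊢
  have hmono := integral_mono_ae (hker_int.const_mul 2)
    ((hρρ.const_mul (Real.log a - 1)).add (hsq.const_mul a⁻¹)) (by
      filter_upwards [ae_prod_fst_ne_snd] with p hp
      have h := mul_le_mul_of_nonneg_right
        (two_mul_log_le_of_pos ha (norm_sub_pos_iff.mpr hp))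
        (mul_nonneg (hρ_nonneg p.1) (hρ_nonneg p.2))
      simp only [Pi.add_apply]
      linarith)
  simp only [Pi.add_apply] at hmono
  rw [integral_add (hρρ.const_mul _) (hsq.const_mul _), integral_const_mul, integral_const_mul,
    integral_const_mul, integral_prod_mul ρ ρ, hM] at hmono
  have hsecond := mul_le_mul_of_nonneg_left hle (inv_pos.mpr ha).le
  have hcancel : a⁻¹ * (2 * M * I) = M ^ 2 := by
    rw [ha_def]
    field_simp
  have hkey : 2 * ∫ p : EuclideanSpace ℝ (Fin 2) × EuclideanSpace ℝ (Fin 2),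
      Real.log ‖p.1 - p.2‖ * (ρ p.1 * ρ p.2) ∂(volume.prod volume) ≤ M ^ 2 * Real.log a := by
    linarith
  have hfinal := mul_le_mul_of_nonneg_left hkey (show 0 ≤ 1 / (4 * π) by positivity)
  calc -(M ^ 2 / (4 * π)) * Real.log a = -(1 / (4 * π) * (M ^ 2 * Real.log a)) := by ring
    _ ≤ _ := neg_le_neg hfinal
    _ = _ := by ring
end
end

section
/- Let d ≥ 3 and let R : [0,∞) → (0,∞) be a C² function satisfying R̈(t) = R(t)^{1−d} for all t ≥ 0, with Ṙ(0) ≥ 0. Then R(t) → +∞ as t → +∞, lim_{t→+∞} Ṙ(t) = lim_{t→+∞} R(t)/t = √( Ṙ(0)² + (2/(d−2)) R(0)^{2−d} ), and lim_{t→+∞} t Ṙ(t)/R(t) = 1. -/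
open MeasureTheory Set Filter Real
open scoped Topology

noncomputable section

/-- If the derivative of `f` tends to `L` at infinity, then so does `f t / t`. -/
theorem tendsto_div_id_of_tendsto_deriv {f : ℝ → ℝ} {L : ℝ} (hf : Differentiable ℝ f)
    (hL : Tendsto (deriv f) atTop (𝓝 L)) : Tendsto (fun t => f t / t) atTop (𝓝 L) := by
  rw [Metric.tendsto_atTop]
  intro ε hε
  obtain ⟨T, hT, hT0⟩ : ∃ T, (∀ x ≥ T, dist (deriv f x) L < ε / 2) ∧ 0 ≤ T := by
    obtain ⟨T, hT⟩ := Metric.tendsto_atTop.1 hL (ε / 2) (half_pos hε)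
    exact ⟨max T 0, fun x hx => hT x ((le_max_left _ _).trans hx), le_max_right _ _⟩
  set C := |f T - L * T| with hC
  refine ⟨max T (2 * C / ε) + 1, fun t ht => ?_⟩
  have hTt : T ≤ t := by linarith [le_max_left T (2 * C / ε)]
  have ht0 : 0 < t := by linarith [le_max_left T (2 * C / ε)]
  have hCt : 2 * C < t * ε := by
    rw [← div_lt_iff₀ hε]
    linarith [le_max_right T (2 * C / ε)]
  have hder (x : ℝ) : HasDerivAt (fun s => f s - L * s) (deriv f x - L) x := by
    simpa using (hf x).hasDerivAt.fun_sub ((hasDerivAt_id x).const_mul L)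
  have h := (convex_Ici T).norm_image_sub_le_of_norm_hasDerivWithin_le
    (f := fun s => f s - L * s) (C := ε / 2)
    (fun x _ => (hder x).hasDerivWithinAt)
    (fun x hx => (hT x hx).le) self_mem_Ici (mem_Ici.2 hTt)
  rw [Real.norm_eq_abs, Real.norm_eq_abs, abs_of_nonneg (sub_nonneg.2 hTt)] at h
  rw [Real.dist_eq, div_sub' ht0.ne', abs_div, abs_of_pos ht0, div_lt_iff₀ ht0]
  have h2 : |f t - t * L| ≤ |f t - L * t - (f T - L * T)| + C := by
    rw [hC]
    refine le_trans (le_of_eq ?_) (abs_add_le _ _)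
    congr 1
    ring
  nlinarith

/-- Conservation of energy for positive solutions of `R̈ = R^{1-d}`. -/
theorem sq_deriv_eq_of_deriv_deriv_eq_zpow {d : ℕ} (hd : 3 ≤ d) {R : ℝ → ℝ}
    (hRpos : ∀ t : ℝ, 0 ≤ t → 0 < R t) (hR : ContDiff ℝ 2 R)
    (hRode : ∀ t : ℝ, 0 ≤ t → deriv (deriv R) t = R t ^ (1 - (d : ℤ)))
    {t : ℝ} (ht : 0 ≤ t) :
    deriv R t ^ 2 = deriv R 0 ^ 2 + (2 / ((d : ℝ) - 2)) * R 0 ^ (2 - (d : ℤ)) -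
      (2 / ((d : ℝ) - 2)) * R t ^ (2 - (d : ℤ)) := by
  have hd' : (0 : ℝ) < d - 2 := by
    have : (3 : ℝ) ≤ d := by exact_mod_cast hd
    linarith
  have hV : Differentiable ℝ (deriv R) :=
    ((contDiff_succ_iff_deriv (n := 1)).1 hR).2.2.differentiable one_ne_zero
  have hder (x : ℝ) (hx : 0 ≤ x) : HasDerivAt
      (fun s => deriv R s ^ 2 + (2 / ((d : ℝ) - 2)) * R s ^ (2 - (d : ℤ))) 0 x := by
    have h1 := (hV x).hasDerivAt.fun_pow 2
    have h2 := ((hasDerivAt_zpow (2 - (d : ℤ)) (R x) (Or.inl (hRpos x hx).ne')).comp x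
      (hR.differentiable two_ne_zero x).hasDerivAt).const_mul (2 / ((d : ℝ) - 2))
    refine (h1.fun_add h2).congr_deriv ?_
    rw [hRode x hx, show 2 - (d : ℤ) - 1 = 1 - d by ring]
    push_cast
    field_simp
    ring
  have h := constant_of_has_deriv_right_zero (a := 0) (b := t)
    (fun x hx => (hder x hx.1).continuousAt.continuousWithinAt)
    (fun x hx => (hder x hx.1).hasDerivWithinAt) t (right_mem_Icc.2 ht)
  linarith

/-- asymptotics of positive solutions of `R̈ = R^{1-d}` on `[0,∞)`
(plasma case, `d ≥ 3`) with `Ṙ(0) ≥ 0`: `R(t) → ∞`,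
`Ṙ(t) → √(Ṙ(0)² + (2/(d-2)) R(0)^{2-d})`, `R(t)/t` tends to the same limit, and
`t Ṙ(t)/R(t) → 1`. -/
theorem stmt19 (d : ℕ) (hd : 3 ≤ d) (R : ℝ → ℝ)
    (hRpos : ∀ t : ℝ, 0 ≤ t → 0 < R t)
    (hR : ContDiff ℝ 2 R)
    (hRode : ∀ t : ℝ, 0 ≤ t → deriv (deriv R) t = R t ^ (1 - (d : ℤ)))
    (hR'0 : 0 ≤ deriv R 0) :
    Filter.Tendsto R Filter.atTop Filter.atTop ∧
    Filter.Tendsto (fun t => deriv R t) Filter.atTop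
      (𝓝 (Real.sqrt (deriv R 0 ^ 2 + (2 / ((d : ℝ) - 2)) * R 0 ^ (2 - (d : ℤ))))) ∧
    Filter.Tendsto (fun t => R t / t) Filter.atTop
      (𝓝 (Real.sqrt (deriv R 0 ^ 2 + (2 / ((d : ℝ) - 2)) * R 0 ^ (2 - (d : ℤ))))) ∧
    Filter.Tendsto (fun t => t * deriv R t / R t) Filter.atTop (𝓝 1) := by
  have hd' : (0 : ℝ) < d - 2 := by
    have : (3 : ℝ) ≤ d := by exact_mod_cast hd
    linarith
  have hRd : Differentiable ℝ R := hR.differentiable two_ne_zero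
  have hVd : Differentiable ℝ (deriv R) :=
    ((contDiff_succ_iff_deriv (n := 1)).1 hR).2.2.differentiable one_ne_zero
  have hVmono : StrictMonoOn (deriv R) (Ici 0) := by
    refine strictMonoOn_of_deriv_pos (convex_Ici 0) hVd.continuous.continuousOn fun x hx => ?_
    have hx0 : 0 ≤ x := interior_subset hx
    rw [hRode x hx0]
    exact zpow_pos (hRpos x hx0) _
  have hV1 : 0 < deriv R 1 :=
    hR'0.trans_lt (hVmono self_mem_Ici (mem_Ici.2 zero_le_one) one_pos)
  have hVnonneg (t : ℝ) (ht : 0 ≤ t) : 0 ≤ deriv R t :=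
    hR'0.trans (hVmono.monotoneOn self_mem_Ici (mem_Ici.2 ht) ht)
  have hRtop : Tendsto R atTop atTop := by
    have hlin : Tendsto (fun t => deriv R 1 * (t - 1)) atTop atTop :=
      (tendsto_atTop_add_const_right _ (-1) tendsto_id).const_mul_atTop hV1
    refine tendsto_atTop_mono' _ ?_ (tendsto_atTop_add_const_right _ (R 1) hlin)
    filter_upwards [eventually_ge_atTop 1] with t ht
    have h := (convex_Ici (1 : ℝ)).mul_sub_le_image_sub_of_le_deriv hRd.continuous.continuousOn
      hRd.differentiableOn (fun x hx => ?_) 1 self_mem_Ici t (mem_Ici.2 ht) ht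
      (C := deriv R 1)
    · linarith
    · have hx1 : 1 ≤ x := interior_subset hx
      exact hVmono.monotoneOn (mem_Ici.2 zero_le_one) (mem_Ici.2 (zero_le_one.trans hx1)) hx1
  have hpow : Tendsto (fun t => R t ^ (2 - (d : ℤ))) atTop (𝓝 0) := by
    have h := (tendsto_pow_neg_atTop (𝕜 := ℝ) (n := d - 2) (by omega)).comp hRtop
    refine h.congr fun t => ?_
    rw [Function.comp_apply, Nat.cast_sub (by omega)]
    congr 1
    push_cast
    ring
  set E := deriv R 0 ^ 2 + (2 / ((d : ℝ) - 2)) * R 0 ^ (2 - (d : ℤ)) with hE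
  have hEpos : 0 < E := by
    have := zpow_pos (hRpos 0 le_rfl) (2 - (d : ℤ))
    positivity
  have hVlim : Tendsto (deriv R) atTop (𝓝 √E) := by
    have h : Tendsto (fun t => √(E - 2 / ((d : ℝ) - 2) * R t ^ (2 - (d : ℤ)))) atTop (𝓝 √E) := by
      simpa using ((hpow.const_mul (2 / ((d : ℝ) - 2))).const_sub E).sqrt
    refine h.congr' ?_
    filter_upwards [eventually_ge_atTop 0] with t ht
    rw [hE, ← sq_deriv_eq_of_deriv_deriv_eq_zpow hd hRpos hR hRode ht,
      Real.sqrt_sq (hVnonneg t ht)]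
  have hdiv := tendsto_div_id_of_tendsto_deriv hRd hVlim
  refine ⟨hRtop, hVlim, hdiv, ?_⟩
  have hE0 : √E ≠ 0 := (Real.sqrt_pos.2 hEpos).ne'
  have h := hVlim.div hdiv hE0
  rw [div_self hE0] at h
  refine h.congr fun t => ?_
  rw [Pi.div_apply, div_div_eq_mul_div, mul_comm]
end
end
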